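/- arXiv:2201.08025 — 5 statements merged into one kernel-verified Lean document; each statement's English description precedes it below -/
import Mathlib

section
/- Let l : ℝ^d → ℝ be differentiable and α-Lipschitz continuous with respect to the Euclidean norm, and let Z ∼ N(0, σ²I_d) with σ > 0. Then the smoothed function l_μ(θ) = E[l(θ + Z)] is continuously differentiable on ℝ^d and its gradient satisfies ∇l_μ(θ) = E[∇l(θ + Z)] for every θ ∈ ℝ^d. -/
open MeasureTheory Real

/-- Density of the centered Gaussian measure `N(0, σ²I_d)` on `ℝ^d`. -/
noncomputable def gaussDensity (d : ℕ) (σ : ℝ) (z : EuclideanSpace ℝ (Fin d)) : ℝ :=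
  (2 * π * σ ^ 2) ^ (-(d : ℝ) / 2) * Real.exp (-‖z‖ ^ 2 / (2 * σ ^ 2))

/-- The Gaussian-smoothed version of `l`: `l_μ(θ) = E_{Z ∼ N(0,σ²I_d)}[l(θ + Z)]`. -/
noncomputable def smoothed (d : ℕ) (σ : ℝ) (l : EuclideanSpace ℝ (Fin d) → ℝ)
    (θ : EuclideanSpace ℝ (Fin d)) : ℝ :=
  ∫ z, l (θ + z) * gaussDensity d σ z

theorem integrable_exp_neg_mul_sq_norm {V : Type*} [NormedAddCommGroup V] [InnerProductSpace ℝ V]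
    [FiniteDimensional ℝ V] [MeasurableSpace V] [BorelSpace V] {b : ℝ} (hb : 0 < b) :
    Integrable (fun v : V => Real.exp (-b * ‖v‖ ^ 2)) := by
  have h := (GaussianFourier.integrable_cexp_neg_mul_sq_norm_add (V := V) (b := (b : ℂ))
    (by simpa using hb) 0 0).norm
  refine h.congr (Filter.Eventually.of_forall fun v => ?_)
  simp [Complex.norm_exp, ← Complex.ofReal_pow]

theorem integrable_norm_mul_exp_neg_mul_sq_norm {V : Type*} [NormedAddCommGroup V]
    [InnerProductSpace ℝ V] [FiniteDimensional ℝ V] [MeasurableSpace V] [BorelSpace V]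
    {b : ℝ} (hb : 0 < b) :
    Integrable (fun v : V => ‖v‖ * Real.exp (-b * ‖v‖ ^ 2)) := by
  have hb2 : 0 < b / 2 := half_pos hb
  refine ((integrable_exp_neg_mul_sq_norm (V := V) hb).add
    ((integrable_exp_neg_mul_sq_norm (V := V) hb2).const_mul (b / 2)⁻¹)).mono'
    (by fun_prop) (Filter.Eventually.of_forall fun v => ?_)
  have hle : b / 2 * ‖v‖ ^ 2 ≤ Real.exp (b / 2 * ‖v‖ ^ 2) := by
    linarith [Real.add_one_le_exp (b / 2 * ‖v‖ ^ 2)]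
  have hsplit : Real.exp (b / 2 * ‖v‖ ^ 2) * Real.exp (-b * ‖v‖ ^ 2)
      = Real.exp (-(b / 2) * ‖v‖ ^ 2) := by
    rw [← Real.exp_add]
    ring_nf
  have hsq : ‖v‖ ^ 2 * Real.exp (-b * ‖v‖ ^ 2)
      ≤ (b / 2)⁻¹ * Real.exp (-(b / 2) * ‖v‖ ^ 2) := by
    rw [← hsplit, le_inv_mul_iff₀ hb2, ← mul_assoc]
    gcongr
  have hnorm : ‖v‖ ≤ 1 + ‖v‖ ^ 2 := by nlinarith [sq_nonneg (‖v‖ - 1)]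
  rw [Real.norm_of_nonneg (by positivity)]
  calc ‖v‖ * Real.exp (-b * ‖v‖ ^ 2) ≤ (1 + ‖v‖ ^ 2) * Real.exp (-b * ‖v‖ ^ 2) := by gcongr
    _ ≤ _ := by simpa [add_mul] using hsq

theorem gaussDensity_nonneg (d : ℕ) (σ : ℝ) (z : EuclideanSpace ℝ (Fin d)) :
    0 ≤ gaussDensity d σ z := by
  unfold gaussDensity
  positivity

theorem continuous_gaussDensity (d : ℕ) (σ : ℝ) : Continuous (gaussDensity d σ) := by
  unfold gaussDensity
  fun_prop

theorem gaussDensity_eq (d : ℕ) (σ : ℝ) (z : EuclideanSpace ℝ (Fin d)) :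
    gaussDensity d σ z =
      (2 * π * σ ^ 2) ^ (-(d : ℝ) / 2) * Real.exp (-(2 * σ ^ 2)⁻¹ * ‖z‖ ^ 2) := by
  unfold gaussDensity
  congr 2
  ring

theorem integrable_gaussDensity (d : ℕ) {σ : ℝ} (hσ : 0 < σ) :
    Integrable (gaussDensity d σ) := by
  simp_rw [funext (gaussDensity_eq d σ)]
  exact (integrable_exp_neg_mul_sq_norm (by positivity)).const_mul _

theorem integrable_norm_mul_gaussDensity (d : ℕ) {σ : ℝ} (hσ : 0 < σ) :
    Integrable (fun z => ‖z‖ * gaussDensity d σ z) := by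
  simp_rw [gaussDensity_eq, mul_left_comm]
  exact (integrable_norm_mul_exp_neg_mul_sq_norm (by positivity)).const_mul _

/-- Near `θ₀` the translates of the Gaussian density are dominated by one integrable function. -/
theorem exists_integrable_bound_gaussDensity_sub (d : ℕ) {σ : ℝ} (hσ : 0 < σ)
    (θ₀ : EuclideanSpace ℝ (Fin d)) :
    ∃ g : EuclideanSpace ℝ (Fin d) → ℝ, Integrable g ∧
      ∀ θ ∈ Metric.ball θ₀ 1, ∀ u, gaussDensity d σ (u - θ) ≤ g u := by
  set b := (2 * σ ^ 2)⁻¹ with hb_def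
  have hb : 0 < b := by positivity
  refine ⟨fun u => (2 * π * σ ^ 2) ^ (-(d : ℝ) / 2) *
    (Real.exp b * Real.exp (-(b / 2) * ‖u - θ₀‖ ^ 2)), ?_, fun θ hθ u => ?_⟩
  · exact (((integrable_exp_neg_mul_sq_norm (half_pos hb)).comp_sub_right θ₀).const_mul
      _).const_mul _
  · beta_reduce
    rw [gaussDensity_eq, ← hb_def, ← Real.exp_add]
    gcongr
    have htri : ‖u - θ₀‖ ≤ ‖u - θ‖ + ‖θ - θ₀‖ := norm_sub_le_norm_sub_add_norm_sub u θ θ₀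
    have hθ' : ‖θ - θ₀‖ < 1 := mem_ball_iff_norm.1 hθ
    have hsq : ‖u - θ₀‖ ^ 2 ≤ 2 * ‖u - θ‖ ^ 2 + 2 := by
      nlinarith [norm_nonneg (u - θ₀), norm_nonneg (u - θ), sq_nonneg (‖u - θ‖ - 1)]
    nlinarith

/-- The Gaussian average of a bounded measurable function is continuous in the centre. -/
theorem continuous_integral_gaussDensity_smul (d : ℕ) {σ : ℝ} (hσ : 0 < σ)
    {F : Type*} [NormedAddCommGroup F] [NormedSpace ℝ F] {f : EuclideanSpace ℝ (Fin d) → F}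
    (hf : StronglyMeasurable f) {C : ℝ} (hC : ∀ x, ‖f x‖ ≤ C) :
    Continuous fun θ => ∫ z, gaussDensity d σ z • f (θ + z) := by
  have hshift : ∀ θ, ∫ z, gaussDensity d σ z • f (θ + z)
      = ∫ u, gaussDensity d σ (u - θ) • f u := fun θ => by
    simpa using integral_add_left_eq_self (μ := volume)
      (fun u => gaussDensity d σ (u - θ) • f u) θ
  simp_rw [hshift]
  refine continuous_iff_continuousAt.2 fun θ₀ => ?_
  obtain ⟨g, hg, hbound⟩ := exists_integrable_bound_gaussDensity_sub d hσ θ₀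
  have hcont := continuous_gaussDensity d σ
  refine continuousAt_of_dominated (bound := fun u => g u * C) ?_ ?_ (hg.mul_const C) ?_
  · refine Filter.Eventually.of_forall fun θ => ?_
    exact (hcont.comp (continuous_sub_right θ)).aestronglyMeasurable.smul hf.aestronglyMeasurable
  · filter_upwards [Metric.ball_mem_nhds θ₀ one_pos] with θ hθ
    refine Filter.Eventually.of_forall fun u => ?_
    rw [norm_smul, Real.norm_of_nonneg (gaussDensity_nonneg d σ _)]
    exact mul_le_mul (hbound θ hθ u) (hC u) (norm_nonneg _)
      ((gaussDensity_nonneg d σ _).trans (hbound θ hθ u))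
  · refine Filter.Eventually.of_forall fun u => ?_
    exact ((hcont.comp (continuous_sub_left u)).smul continuous_const).continuousAt

theorem integrable_lipschitz_mul_gaussDensity {d : ℕ} {α σ : ℝ} (hσ : 0 < σ)
    {l : EuclideanSpace ℝ (Fin d) → ℝ} (hl : Continuous l)
    (hlip : ∀ x y, |l x - l y| ≤ α * ‖x - y‖) (θ : EuclideanSpace ℝ (Fin d)) :
    Integrable fun z => l (θ + z) * gaussDensity d σ z := by
  have hcont := continuous_gaussDensity d σ
  refine (((integrable_gaussDensity d hσ).const_mul |l θ|).add
    ((integrable_norm_mul_gaussDensity d hσ).const_mul α)).mono'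
    (by fun_prop) (Filter.Eventually.of_forall fun z => ?_)
  have h := hlip (θ + z) θ
  rw [add_sub_cancel_left] at h
  have hle : |l (θ + z)| ≤ |l θ| + α * ‖z‖ := by
    linarith [abs_sub_abs_le_abs_sub (l (θ + z)) (l θ)]
  rw [norm_mul, Real.norm_of_nonneg (gaussDensity_nonneg d σ z), Real.norm_eq_abs]
  refine (mul_le_mul_of_nonneg_right hle (gaussDensity_nonneg d σ z)).trans_eq ?_
  simp only [Pi.add_apply]
  ring

theorem hasFDerivAt_smoothed {d : ℕ} {α σ : ℝ} (hσ : 0 < σ)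
    {l : EuclideanSpace ℝ (Fin d) → ℝ} (hdiff : Differentiable ℝ l)
    (hlip : ∀ x y, |l x - l y| ≤ α * ‖x - y‖) (θ : EuclideanSpace ℝ (Fin d)) :
    HasFDerivAt (smoothed d σ l) (∫ z, gaussDensity d σ z • fderiv ℝ l (θ + z)) θ := by
  have hcont := continuous_gaussDensity d σ
  have hl := hdiff.continuous
  refine (hasFDerivAt_integral_of_dominated_loc_of_lip'
    (F := fun θ z => l (θ + z) * gaussDensity d σ z)
    (bound := fun z => α * gaussDensity d σ z) Filter.univ_mem
    (fun x _ => by fun_prop) (integrable_lipschitz_mul_gaussDensity hσ hl hlip θ) ?_ ?_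
    ((integrable_gaussDensity d hσ).const_mul α) ?_).2
  · exact hcont.aestronglyMeasurable.smul
      (((measurable_fderiv ℝ l).comp (measurable_const_add θ)).aestronglyMeasurable)
  · refine Filter.Eventually.of_forall fun z x _ => ?_
    have h := hlip (x + z) (θ + z)
    rw [add_sub_add_right_eq_sub] at h
    rw [← sub_mul, norm_mul, Real.norm_of_nonneg (gaussDensity_nonneg d σ z), Real.norm_eq_abs]
    exact (mul_le_mul_of_nonneg_right h (gaussDensity_nonneg d σ z)).trans_eq (by ring)
  · refine Filter.Eventually.of_forall fun z => ?_
    exact ((hasFDerivAt_comp_add_right z).2 (hdiff (θ + z)).hasFDerivAt).mul_const _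

/-- If `l` is differentiable and `α`-Lipschitz, its Gaussian smoothing `l_μ` is
continuously differentiable with `∇l_μ(θ) = E[∇l(θ + Z)]`. -/
theorem stmt_1 {d : ℕ} (α σ : ℝ) (hα : 0 < α) (hσ : 0 < σ)
    (l : EuclideanSpace ℝ (Fin d) → ℝ) (hdiff : Differentiable ℝ l)
    (hlip : ∀ x y, |l x - l y| ≤ α * ‖x - y‖) :
    ContDiff ℝ 1 (smoothed d σ l) ∧
      ∀ θ : EuclideanSpace ℝ (Fin d),
        gradient (smoothed d σ l) θ = ∫ z, gaussDensity d σ z • gradient l (θ + z) := by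
  have hderiv := hasFDerivAt_smoothed hσ hdiff hlip
  refine ⟨contDiff_one_iff_hasFDerivAt.2 ⟨_, ?_, hderiv⟩, fun θ => ?_⟩
  · exact continuous_integral_gaussDensity_smul d hσ (measurable_fderiv ℝ l).stronglyMeasurable
      fun x => norm_fderiv_le_of_lip' ℝ hα.le (Filter.Eventually.of_forall fun y => hlip y x)
  · rw [gradient, (hderiv θ).fderiv]
    refine ((InnerProductSpace.toDual ℝ
      (EuclideanSpace ℝ (Fin d))).symm.toContinuousLinearEquiv.integral_comp_comm _).symm.trans ?_
    simp [gradient]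
end

section
/- Let l : ℝ^d → ℝ be differentiable and α-Lipschitz continuous with respect to the Euclidean norm, and let μ be a probability density on ℝ^d (e.g. the density of N(0, σ²I_d)). Define l_μ(θ) = ∫ l(θ + z) μ(z) dz, whose gradient is ∇l_μ(θ) = ∫ ∇l(θ + z) μ(z) dz. Then for all x, y ∈ ℝ^d, ‖∇l_μ(x) − ∇l_μ(y)‖ ≤ α ∫_{ℝ^d} |μ(z − x) − μ(z − y)| dz. -/
open MeasureTheory Real

/-- The gradient of a function on a finite-dimensional space is measurable. -/
theorem measurable_gradient {E : Type*} [NormedAddCommGroup E] [InnerProductSpace ℝ E]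
    [FiniteDimensional ℝ E] [MeasurableSpace E] [BorelSpace E] (l : E → ℝ) :
    Measurable (gradient l) :=
  (InnerProductSpace.toDual ℝ E).symm.continuous.measurable.comp (measurable_fderiv ℝ l)

theorem norm_gradient_le_of_lipschitz {E : Type*} [NormedAddCommGroup E] [InnerProductSpace ℝ E]
    [CompleteSpace E] {l : E → ℝ} {α : ℝ} (hα : 0 ≤ α)
    (hlip : ∀ x y, |l x - l y| ≤ α * ‖x - y‖) (x : E) : ‖gradient l x‖ ≤ α := by
  lift α to NNReal using hα
  have hl : LipschitzWith α l :=
    LipschitzWith.of_dist_le_mul fun x y => by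
      rw [Real.dist_eq, dist_eq_norm]
      exact hlip x y
  simpa [gradient] using norm_fderiv_le_of_lipschitz ℝ hl (x₀ := x)

/-- Translating a bounded function by `x` and `y` changes its average against an integrable weight
by at most its bound times the `L¹` distance of the translated weights. -/
theorem norm_integral_smul_translate_sub_le {G F : Type*} [AddCommGroup G] [MeasurableSpace G]
    [MeasurableAdd G] {ν : Measure G} [ν.IsAddLeftInvariant]
    [NormedAddCommGroup F] [NormedSpace ℝ F] {g : G → F} {w : G → ℝ} {C : ℝ}
    (hg : AEStronglyMeasurable g ν) (hC : ∀ z, ‖g z‖ ≤ C) (hw : Integrable w ν) (x y : G) :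
    ‖(∫ z, w z • g (x + z) ∂ν) - ∫ z, w z • g (y + z) ∂ν‖ ≤
      C * ∫ z, |w (z - x) - w (z - y)| ∂ν := by
  have hshift (a : G) : ∫ z, w z • g (a + z) ∂ν = ∫ z, w (z - a) • g z ∂ν := by
    simpa using integral_add_left_eq_self (μ := ν) (fun z => w (z - a) • g z) a
  have hw' (a : G) : Integrable (fun z => w (z - a)) ν := by
    simpa [sub_eq_neg_add] using hw.comp_add_left (-a)
  have hint (a : G) : Integrable (fun z => w (z - a) • g z) ν :=
    (hw' a).smul_bdd C hg (.of_forall hC)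
  rw [hshift x, hshift y, ← integral_sub (hint x) (hint y), ← integral_const_mul]
  refine norm_integral_le_of_norm_le (((hw' x).sub (hw' y)).abs.const_mul C) (.of_forall fun z => ?_)
  rw [← sub_smul, norm_smul, Real.norm_eq_abs, mul_comm]
  exact mul_le_mul_of_nonneg_right (hC z) (abs_nonneg _)

/-- If `l` is differentiable and `α`-Lipschitz and `μ` is a probability density on `ℝ^d`,
then the gradient `∇l_μ(θ) = ∫ ∇l(θ + z) μ(z) dz` of the smoothed function satisfies
`‖∇l_μ(x) − ∇l_μ(y)‖ ≤ α ∫ |μ(z − x) − μ(z − y)| dz`. -/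
theorem stmt_2 {d : ℕ} (α : ℝ) (hα : 0 < α)
    (l : EuclideanSpace ℝ (Fin d) → ℝ) (hdiff : Differentiable ℝ l)
    (hlip : ∀ x y, |l x - l y| ≤ α * ‖x - y‖)
    (μ : EuclideanSpace ℝ (Fin d) → ℝ) (hμ0 : ∀ z, 0 ≤ μ z)
    (hμ1 : (∫ z, μ z) = 1) :
    ∀ x y : EuclideanSpace ℝ (Fin d),
      ‖(∫ z, μ z • gradient l (x + z)) - ∫ z, μ z • gradient l (y + z)‖ ≤
        α * ∫ z, |μ (z - x) - μ (z - y)| := by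
  have hμ : Integrable μ := .of_integral_ne_zero (by simp [hμ1])
  exact norm_integral_smul_translate_sub_le (measurable_gradient l).aestronglyMeasurable
    (norm_gradient_le_of_lipschitz hα.le hlip) hμ
end

section
/- Let μ be the density of N(0, σ²I_d) on ℝ^d, i.e. μ(z) = (2πσ²)^{−d/2} exp(−‖z‖²/(2σ²)) with σ > 0. Then for all x, y ∈ ℝ^d with x ≠ y, writing r = ‖x − y‖, one has ∫_{ℝ^d} |μ(z − x) − μ(z − y)| dz = 2 ∫_{−r/2}^{r/2} (2πσ²)^{−1/2} exp(−u²/(2σ²)) du. -/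
open MeasureTheory Real

open ProbabilityTheory

/-- The isotropic Gaussian density is the product of its one-dimensional marginals. -/
lemma gaussDensity_eq_prod_gaussianPDFReal (d : ℕ) (σ : ℝ) (z : EuclideanSpace ℝ (Fin d)) :
    gaussDensity d σ z = ∏ i, gaussianPDFReal 0 (Real.toNNReal (σ ^ 2)) (z i) := by
  have h : 0 ≤ 2 * π * σ ^ 2 := by positivity
  simp only [gaussDensity, gaussianPDFReal, Real.coe_toNNReal _ (sq_nonneg σ), sub_zero,
    Finset.prod_mul_distrib, Finset.prod_const, Finset.card_univ, Fintype.card_fin,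
    ← Real.exp_sum, EuclideanSpace.real_norm_sq_eq, ← Finset.sum_div, Finset.sum_neg_distrib]
  congr 1
  rw [Real.sqrt_eq_rpow, ← Real.rpow_neg h, ← Real.rpow_natCast _ d, ← Real.rpow_mul h]
  congr 1
  ring

/-- `L¹` distance of two translates of a centered real Gaussian density. -/
lemma integral_abs_gaussianPDFReal_sub (v : NNReal) {s : ℝ} (hs : 0 ≤ s) :
    ∫ u, |gaussianPDFReal 0 v (u - s) - gaussianPDFReal 0 v (u + s)| =
      2 * ∫ u in (-s)..s, gaussianPDFReal 0 v u := by
  have habs (u : ℝ) : |gaussianPDFReal 0 v (u - s) - gaussianPDFReal 0 v (u + s)| =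
      gaussianPDFReal 0 v (|u| - s) - gaussianPDFReal 0 v (|u| + s) := by
    have hmono (t : ℝ) (ht : 0 ≤ t) :
        gaussianPDFReal 0 v (t + s) ≤ gaussianPDFReal 0 v (t - s) := by
      simp only [gaussianPDFReal, sub_zero]
      gcongr ?_ * Real.exp (-?_ / _)
      nlinarith [mul_nonneg ht hs]
    have heven (t : ℝ) : gaussianPDFReal 0 v (-t) = gaussianPDFReal 0 v t := by
      simp [gaussianPDFReal]
    rcases le_total 0 u with hu | hu
    · rw [abs_of_nonneg hu, abs_of_nonneg (sub_nonneg.2 (hmono u hu))]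
    · have h := hmono (-u) (neg_nonneg.2 hu)
      rw [abs_of_nonpos hu, ← heven (u - s), ← heven (u + s), abs_sub_comm,
        show -(u + s) = -u - s by ring, show -(u - s) = -u + s by ring,
        abs_of_nonneg (sub_nonneg.2 h)]
  have hgauss := integrable_gaussianPDFReal 0 v
  simp_rw [habs]
  rw [integral_comp_abs
      (f := fun u ↦ gaussianPDFReal 0 v (u - s) - gaussianPDFReal 0 v (u + s)),
    integral_sub (hgauss.comp_sub_right s).integrableOn (hgauss.comp_add_right s).integrableOn]
  congr 1
  have h1 : ∫ u in Set.Ioi 0, gaussianPDFReal 0 v (u - s) =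
      ∫ u in Set.Ioi (-s), gaussianPDFReal 0 v u := by
    have := (measurePreserving_sub_right volume s).setIntegral_preimage_emb
      (measurableEmbedding_subRight s) (gaussianPDFReal 0 v) (Set.Ioi (-s))
    simpa using this
  have h2 : ∫ u in Set.Ioi 0, gaussianPDFReal 0 v (u + s) =
      ∫ u in Set.Ioi s, gaussianPDFReal 0 v u := by
    have := (measurePreserving_add_right volume s).setIntegral_preimage_emb
      (measurableEmbedding_addRight s) (gaussianPDFReal 0 v) (Set.Ioi s)
    simpa using this
  rw [h1, h2, intervalIntegral.integral_Ioi_sub_Ioi hgauss.integrableOn (by linarith)]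

/-- Two translates of an isotropic Gaussian along a coordinate axis are as far apart in `L¹` as
their one-dimensional marginals along this axis. -/
lemma integral_abs_gaussDensity_sub_single {d : ℕ} {σ : ℝ} (hσ : 0 < σ) (k : Fin d) (s : ℝ) :
    ∫ z, |gaussDensity d σ (z - EuclideanSpace.single k s) -
        gaussDensity d σ (z + EuclideanSpace.single k s)| =
      ∫ u, |gaussianPDFReal 0 (Real.toNNReal (σ ^ 2)) (u - s) -
        gaussianPDFReal 0 (Real.toNNReal (σ ^ 2)) (u + s)| := by
  set g := gaussianPDFReal 0 (Real.toNNReal (σ ^ 2)) with hg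
  have hg1 : ∫ u, g u = 1 := integral_gaussianPDFReal_eq_one 0 (by simp [hσ.ne'])
  let f : Fin d → ℝ → ℝ := fun i u ↦ if i = k then |g (u - s) - g (u + s)| else g u
  have hf (w : Fin d → ℝ) : |gaussDensity d σ (WithLp.toLp 2 w - EuclideanSpace.single k s) -
      gaussDensity d σ (WithLp.toLp 2 w + EuclideanSpace.single k s)| = ∏ i, f i (w i) := by
    simp only [gaussDensity_eq_prod_gaussianPDFReal, ← hg]
    rw [← Finset.mul_prod_erase _ _ (Finset.mem_univ k),
      ← Finset.mul_prod_erase _ _ (Finset.mem_univ k),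
      ← Finset.mul_prod_erase _ (fun i ↦ f i (w i)) (Finset.mem_univ k)]
    have h1 : ∏ i ∈ Finset.univ.erase k,
        g ((WithLp.toLp 2 w - EuclideanSpace.single k s) i) =
        ∏ i ∈ Finset.univ.erase k, g (w i) :=
      Finset.prod_congr rfl fun i hi ↦ by simp [Finset.ne_of_mem_erase hi]
    have h2 : ∏ i ∈ Finset.univ.erase k,
        g ((WithLp.toLp 2 w + EuclideanSpace.single k s) i) =
        ∏ i ∈ Finset.univ.erase k, g (w i) :=
      Finset.prod_congr rfl fun i hi ↦ by simp [Finset.ne_of_mem_erase hi]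
    have h3 : ∏ i ∈ Finset.univ.erase k, f i (w i) = ∏ i ∈ Finset.univ.erase k, g (w i) :=
      Finset.prod_congr rfl fun i hi ↦ by simp [f, Finset.ne_of_mem_erase hi]
    rw [h1, h2, h3, ← sub_mul, abs_mul,
      abs_of_nonneg (Finset.prod_nonneg fun i _ ↦ gaussianPDFReal_nonneg _ _ _)]
    simp [f, hg]
  rw [← (PiLp.volume_preserving_toLp (Fin d)).integral_comp
    (MeasurableEquiv.toLp 2 (Fin d → ℝ)).measurableEmbedding]
  simp_rw [hf]
  rw [integral_fintype_prod_volume_eq_prod, Finset.prod_eq_single k]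
  · simp [f]
  · intro i _ hi
    simp [f, hi, hg1]
  · simp

lemma gaussDensity_linearIsometryEquiv {d : ℕ} (σ : ℝ)
    (e : EuclideanSpace ℝ (Fin d) ≃ₗᵢ[ℝ] EuclideanSpace ℝ (Fin d))
    (z : EuclideanSpace ℝ (Fin d)) : gaussDensity d σ (e z) = gaussDensity d σ z := by
  simp [gaussDensity]

/-- Every vector can be rotated onto any given coordinate axis. -/
lemma exists_linearIsometryEquiv_single {d : ℕ} (k : Fin d) {a : EuclideanSpace ℝ (Fin d)}
    (ha : a ≠ 0) : ∃ e : EuclideanSpace ℝ (Fin d) ≃ₗᵢ[ℝ] EuclideanSpace ℝ (Fin d),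
      e (EuclideanSpace.single k ‖a‖) = a := by
  have hv : Orthonormal ℝ (({k} : Set (Fin d)).domRestrict fun _ ↦ ‖a‖⁻¹ • a) := by
    refine ⟨fun i ↦ ?_, fun i j hij ↦ (hij (Subsingleton.elim i j)).elim⟩
    simp [Set.domRestrict, norm_smul, ha]
  obtain ⟨b, hb⟩ := hv.exists_orthonormalBasis_extension_of_card_eq (by simp)
  refine ⟨b.repr.symm, ?_⟩
  have h : EuclideanSpace.single k ‖a‖ = ‖a‖ • EuclideanSpace.single k (1 : ℝ) := by
    ext i; simp
  rw [h, map_smul, b.repr_symm_single, hb k rfl, smul_inv_smul₀ (norm_ne_zero_iff.2 ha)]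

/-- The L¹ distance between the densities of `N(x, σ²I_d)` and `N(y, σ²I_d)` equals
`2 ∫_{−r/2}^{r/2} (2πσ²)^{−1/2} exp(−u²/(2σ²)) du` where `r = ‖x − y‖`. -/
theorem stmt_3 {d : ℕ} (σ : ℝ) (hσ : 0 < σ)
    (x y : EuclideanSpace ℝ (Fin d)) (hxy : x ≠ y) :
    (∫ z, |gaussDensity d σ (z - x) - gaussDensity d σ (z - y)|) =
      2 * ∫ u in (-(‖x - y‖ / 2))..(‖x - y‖ / 2),
        (2 * π * σ ^ 2) ^ (-(1 : ℝ) / 2) * Real.exp (-u ^ 2 / (2 * σ ^ 2)) := by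
  obtain ⟨k⟩ : Nonempty (Fin d) := by
    by_contra h
    rw [not_nonempty_iff] at h
    exact hxy (Subsingleton.elim x y)
  set a := (1 / 2 : ℝ) • (x - y) with ha
  have hnorm : ‖a‖ = ‖x - y‖ / 2 := by
    rw [ha, norm_smul]; norm_num; ring
  have ha0 : a ≠ 0 := smul_ne_zero (by norm_num) (sub_ne_zero.2 hxy)
  obtain ⟨e, he⟩ := exists_linearIsometryEquiv_single k ha0
  have hx (z : EuclideanSpace ℝ (Fin d)) : z + (1 / 2 : ℝ) • (x + y) - x = z - a := by
    rw [ha]; module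
  have hy (z : EuclideanSpace ℝ (Fin d)) : z + (1 / 2 : ℝ) • (x + y) - y = z + a := by
    rw [ha]; module
  rw [← integral_add_right_eq_self _ ((1 / 2 : ℝ) • (x + y))]
  simp_rw [hx, hy]
  rw [← e.measurePreserving.integral_comp e.toMeasurableEquiv.measurableEmbedding, ← he]
  simp_rw [← map_sub, ← map_add, gaussDensity_linearIsometryEquiv]
  rw [integral_abs_gaussDensity_sub_single hσ,
    integral_abs_gaussianPDFReal_sub _ (norm_nonneg a), hnorm]
  have h : 0 ≤ 2 * π * σ ^ 2 := by positivity
  simp only [gaussianPDFReal, Real.coe_toNNReal _ (sq_nonneg σ), sub_zero, neg_div,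
    Real.sqrt_eq_rpow, ← Real.rpow_neg h]
end

section
/- Let μ be the density of the anisotropic Gaussian N(0, Σ) on ℝ^d with diagonal covariance Σ = diag(σ_1², …, σ_d²), all σ_i > 0, and set σ_− = min_i σ_i. Then for all x, y ∈ ℝ^d, ∫_{ℝ^d} |μ(z − x) − μ(z − y)| dz ≤ (√2/(σ_− √π)) ‖x − y‖ ≤ ‖x − y‖ / σ_−. -/
open MeasureTheory Real

/-- Density of the anisotropic Gaussian `N(0, diag(σ_1², …, σ_d²))` on `ℝ^d`. -/
noncomputable def anisoGaussDensity (d : ℕ) (σ : Fin d → ℝ)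
    (z : EuclideanSpace ℝ (Fin d)) : ℝ :=
  ∏ i, (2 * π * σ i ^ 2) ^ (-(1 : ℝ) / 2) * Real.exp (-(z i) ^ 2 / (2 * σ i ^ 2))

open ProbabilityTheory
open scoped NNReal ENNReal

/-- The `L¹` distance between two translates of a `C¹` function is at most the `L¹` norm of its
derivative in the direction of the displacement. -/
lemma lintegral_enorm_sub_translate_le {E : Type*} [NormedAddCommGroup E] [NormedSpace ℝ E]
    [FiniteDimensional ℝ E] [MeasurableSpace E] [BorelSpace E] (ν : Measure E)
    [ν.IsAddHaarMeasure] {f : E → ℝ} (hf : ContDiff ℝ 1 f) (x y : E) :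
    ∫⁻ z, ‖f (z - x) - f (z - y)‖ₑ ∂ν ≤ ∫⁻ z, ‖fderiv ℝ f z (x - y)‖ₑ ∂ν := by
  have hcont : Continuous fun z ↦ fderiv ℝ f z (x - y) :=
    (hf.continuous_fderiv one_ne_zero).clm_apply continuous_const
  have hline (z : E) : ‖f (z - x) - f (z - y)‖ₑ ≤
      ∫⁻ t in Set.Icc (0 : ℝ) 1, ‖fderiv ℝ f (z - (y + t • (x - y))) (x - y)‖ₑ := by
    have hder (t : ℝ) : HasDerivAt (fun t : ℝ ↦ f (z - (y + t • (x - y))))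
        (-fderiv ℝ f (z - (y + t • (x - y))) (x - y)) t := by
      have hpath : HasDerivAt (fun t : ℝ ↦ z - (y + t • (x - y))) (-(x - y)) t := by
        simpa using (((hasDerivAt_id t).smul_const (x - y)).const_add y).const_sub z
      exact ((hf.differentiable one_ne_zero _).hasFDerivAt.comp_hasDerivAt t hpath).congr_deriv
        (map_neg _ _)
    have hC : ContDiff ℝ 1 (fun t : ℝ ↦ f (z - (y + t • (x - y)))) := by fun_prop
    simpa only [(hder _).deriv, enorm_neg, one_smul, zero_smul, add_zero, add_sub_cancel] using
      enorm_sub_le_lintegral_deriv_of_contDiffOn_Icc hC.contDiffOn zero_le_one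
  calc ∫⁻ z, ‖f (z - x) - f (z - y)‖ₑ ∂ν
      ≤ ∫⁻ z, ∫⁻ t in Set.Icc (0 : ℝ) 1,
          ‖fderiv ℝ f (z - (y + t • (x - y))) (x - y)‖ₑ ∂volume ∂ν := lintegral_mono hline
    _ = ∫⁻ t in Set.Icc (0 : ℝ) 1, ∫⁻ z,
          ‖fderiv ℝ f (z - (y + t • (x - y))) (x - y)‖ₑ ∂ν := by
        refine lintegral_lintegral_swap (Measurable.aemeasurable ?_)
        exact (hcont.comp (g := fun z ↦ fderiv ℝ f z (x - y))
          (f := fun p : E × ℝ ↦ p.1 - (y + p.2 • (x - y))) (by fun_prop)).enorm.measurable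
    _ = ∫⁻ z, ‖fderiv ℝ f z (x - y)‖ₑ ∂ν := by
        simp_rw [lintegral_sub_right_eq_self (μ := ν) (fun z ↦ ‖fderiv ℝ f z (x - y)‖ₑ)]
        simp

/-- The first absolute moment of a centered real Gaussian. -/
lemma lintegral_enorm_gaussianReal (v : ℝ≥0) :
    ∫⁻ u, ‖u‖ₑ ∂gaussianReal 0 v = ENNReal.ofReal √(2 * v / π) := by
  rcases eq_or_ne v 0 with rfl | hv
  · simp
  have hv' : (0 : ℝ) < v := NNReal.coe_pos.2 (pos_iff_ne_zero.2 hv)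
  have hintegrable : Integrable (fun u : ℝ ↦ u) (gaussianReal 0 v) :=
    (memLp_id_gaussianReal 1).integrable (by simp)
  rw [← ofReal_integral_norm_eq_lintegral_enorm hintegrable,
    integral_gaussianReal_eq_integral_smul hv]
  congr 1
  have h := integral_rpow_mul_exp_neg_mul_rpow (p := 2) (q := 1) (b := (2 * v : ℝ)⁻¹)
    (by norm_num) (by norm_num) (by positivity)
  norm_num [Real.rpow_neg_one] at h
  calc ∫ u, gaussianPDFReal 0 v u • ‖u‖
      = ∫ u, (fun w ↦ (√(2 * π * v))⁻¹ * (w * rexp (-((v : ℝ)⁻¹ * (1 / 2) * w ^ 2)))) |u| := by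
        congr with u
        simp [gaussianPDFReal]
        field_simp
    _ = 2 * ((√(2 * π * v))⁻¹ * v) := by
        rw [integral_comp_abs
          (f := fun w ↦ (√(2 * π * v))⁻¹ * (w * rexp (-((v : ℝ)⁻¹ * (1 / 2) * w ^ 2)))),
          integral_const_mul, h]
        ring
    _ = √(2 * v / π) := by
        symm
        rw [Real.sqrt_eq_iff_mul_self_eq (by positivity) (by positivity)]
        field_simp
        exact Real.sq_sqrt (by positivity)

lemma anisoGaussDensity_eq_prod_gaussianPDFReal {d : ℕ} (σ : Fin d → ℝ)
    (z : EuclideanSpace ℝ (Fin d)) :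
    anisoGaussDensity d σ z = ∏ i, gaussianPDFReal 0 (Real.toNNReal (σ i ^ 2)) (z i) := by
  refine Finset.prod_congr rfl fun i _ ↦ ?_
  rw [gaussianPDFReal, Real.coe_toNNReal _ (sq_nonneg _), sub_zero, neg_div,
    Real.rpow_neg (by positivity), Real.sqrt_eq_rpow]

lemma anisoGaussDensity_nonneg {d : ℕ} (σ : Fin d → ℝ) (z : EuclideanSpace ℝ (Fin d)) :
    0 ≤ anisoGaussDensity d σ z :=
  Finset.prod_nonneg fun _ _ ↦ by positivity

lemma contDiff_anisoGaussDensity {d : ℕ} (σ : Fin d → ℝ) :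
    ContDiff ℝ 1 (anisoGaussDensity d σ) := by
  unfold anisoGaussDensity
  fun_prop

lemma fderiv_anisoGaussDensity_apply {d : ℕ} (σ : Fin d → ℝ) (z h : EuclideanSpace ℝ (Fin d)) :
    fderiv ℝ (anisoGaussDensity d σ) z h =
      -(anisoGaussDensity d σ z * ∑ i, h i / σ i ^ 2 * z i) := by
  have hline : HasDerivAt (fun t : ℝ ↦ z + t • h) h 0 := by
    simpa using ((hasDerivAt_id (0 : ℝ)).smul_const h).const_add z
  have hchain : HasDerivAt (fun t : ℝ ↦ anisoGaussDensity d σ (z + t • h))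
      (fderiv ℝ (anisoGaussDensity d σ) z h) 0 :=
    HasFDerivAt.comp_hasDerivAt (l := anisoGaussDensity d σ) 0 (by
      rw [zero_smul, add_zero]
      exact ((contDiff_anisoGaussDensity σ).differentiable one_ne_zero z).hasFDerivAt) hline
  refine hchain.unique ?_
  have hexp : HasDerivAt (fun t : ℝ ↦ (∏ i, (2 * π * σ i ^ 2) ^ (-(1 : ℝ) / 2)) *
      rexp (∑ i, -(z i + t * h i) ^ 2 / (2 * σ i ^ 2)))
      ((∏ i, (2 * π * σ i ^ 2) ^ (-(1 : ℝ) / 2)) *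
      (rexp (∑ i, -(z i + 0 * h i) ^ 2 / (2 * σ i ^ 2)) *
        ∑ i, -(2 * (z i + 0 * h i) * h i) / (2 * σ i ^ 2))) 0 := by
    refine (HasDerivAt.exp (HasDerivAt.fun_sum fun i _ ↦ ?_)).const_mul _
    have := (((hasDerivAt_id (0 : ℝ)).mul_const (h i)).const_add (z i)).pow 2
    simpa using (this.neg.div_const (2 * σ i ^ 2))
  have hfun : (fun t : ℝ ↦ anisoGaussDensity d σ (z + t • h)) = fun t ↦
      (∏ i, (2 * π * σ i ^ 2) ^ (-(1 : ℝ) / 2)) *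
        rexp (∑ i, -(z i + t * h i) ^ 2 / (2 * σ i ^ 2)) := by
    ext t
    simp [anisoGaussDensity, Finset.prod_mul_distrib, Real.exp_sum]
  rw [hfun]
  refine hexp.congr_deriv ?_
  simp only [anisoGaussDensity, Finset.prod_mul_distrib, Real.exp_sum, zero_mul, add_zero]
  rw [← mul_assoc, ← mul_neg, ← Finset.sum_neg_distrib]
  congr 1
  refine Finset.sum_congr rfl fun i _ ↦ ?_
  ring

lemma integrable_anisoGaussDensity {d : ℕ} (σ : Fin d → ℝ) :
    Integrable (anisoGaussDensity d σ) := by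
  have h : Integrable fun w : Fin d → ℝ ↦
      ∏ i, gaussianPDFReal 0 (Real.toNNReal (σ i ^ 2)) (w i) :=
    Integrable.fintype_prod fun i ↦ integrable_gaussianPDFReal 0 _
  simpa only [Function.comp_def, ← anisoGaussDensity_eq_prod_gaussianPDFReal] using
    (PiLp.volume_preserving_ofLp (Fin d)).integrable_comp_of_integrable h

/-- Under the density `anisoGaussDensity d σ`, a linear functional has a centered Gaussian law. -/
lemma map_withDensity_anisoGaussDensity {d : ℕ} {σ : Fin d → ℝ} (hσ : ∀ i, 0 < σ i)
    (a : Fin d → ℝ) :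
    (volume.withDensity fun z ↦ ENNReal.ofReal (anisoGaussDensity d σ z)).map
        (fun z ↦ ∑ i, a i * z i) =
      gaussianReal 0 (Real.toNNReal (∑ i, a i ^ 2 * σ i ^ 2)) := by
  have := isFiniteMeasure_withDensity_ofReal (integrable_anisoGaussDensity σ).hasFiniteIntegral
  refine Measure.ext_of_charFun (funext fun t ↦ ?_)
  have hfactor (i : Fin d) :
      ∫ u : ℝ, (gaussianPDFReal 0 (Real.toNNReal (σ i ^ 2)) u : ℂ) *
        Complex.exp (t * a i * u * Complex.I) =
      Complex.exp (-(a i ^ 2 * σ i ^ 2) * t ^ 2 / 2) := by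
    have hv : Real.toNNReal (σ i ^ 2) ≠ 0 := by
      simpa using (hσ i).ne'
    have h := charFun_gaussianReal (μ := 0) (v := Real.toNNReal (σ i ^ 2)) (t * a i)
    rw [charFun_apply_real, integral_gaussianReal_eq_integral_smul hv] at h
    simpa [max_eq_left (sq_nonneg (σ i)), mul_pow, neg_div, mul_assoc, mul_left_comm, mul_comm]
      using h
  rw [charFun_apply_real, integral_map (by fun_prop) (by fun_prop),
    integral_withDensity_eq_integral_toReal_smul
      (contDiff_anisoGaussDensity σ).continuous.measurable.ennreal_ofReal
      (ae_of_all _ fun _ ↦ ENNReal.ofReal_lt_top)]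
  calc ∫ z : EuclideanSpace ℝ (Fin d), (ENNReal.ofReal (anisoGaussDensity d σ z)).toReal •
        Complex.exp (t * ↑(∑ i, a i * z i) * Complex.I)
      = ∫ z : EuclideanSpace ℝ (Fin d),
          ∏ i, ((gaussianPDFReal 0 (Real.toNNReal (σ i ^ 2)) (z i) : ℂ) *
            Complex.exp (t * a i * z i * Complex.I)) := by
        congr with z
        rw [ENNReal.toReal_ofReal (anisoGaussDensity_nonneg σ z),
          anisoGaussDensity_eq_prod_gaussianPDFReal, Finset.prod_mul_distrib, ← Complex.exp_sum]
        simp [Finset.mul_sum, Finset.sum_mul, mul_assoc]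
    _ = ∫ w : Fin d → ℝ,
          ∏ i, ((gaussianPDFReal 0 (Real.toNNReal (σ i ^ 2)) (w i) : ℂ) *
            Complex.exp (t * a i * w i * Complex.I)) :=
        (EuclideanSpace.volume_preserving_symm_measurableEquiv_toLp (Fin d)).integral_comp'
          (fun w : Fin d → ℝ ↦ ∏ i, ((gaussianPDFReal 0 (Real.toNNReal (σ i ^ 2)) (w i) : ℂ) *
            Complex.exp (t * a i * w i * Complex.I)))
    _ = ∏ i, Complex.exp (-(a i ^ 2 * σ i ^ 2) * t ^ 2 / 2) := by
        rw [integral_fintype_prod_volume_eq_prod (fun i (u : ℝ) ↦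
          (gaussianPDFReal 0 (Real.toNNReal (σ i ^ 2)) u : ℂ) *
            Complex.exp (t * a i * u * Complex.I))]
        exact Finset.prod_congr rfl fun i _ ↦ hfactor i
    _ = charFun (gaussianReal 0 (Real.toNNReal (∑ i, a i ^ 2 * σ i ^ 2))) t := by
        rw [charFun_gaussianReal, ← Complex.exp_sum,
          Real.coe_toNNReal _ (Finset.sum_nonneg fun i _ ↦ by positivity)]
        congr 1
        simp [Finset.sum_mul, Finset.sum_div, neg_div]

/-- The `L¹` norm of a directional derivative of the density is the first absolute moment of a
Gaussian of variance `∑ i, h i ^ 2 / σ i ^ 2`. -/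
lemma lintegral_enorm_fderiv_anisoGaussDensity {d : ℕ} {σ : Fin d → ℝ} (hσ : ∀ i, 0 < σ i)
    (h : EuclideanSpace ℝ (Fin d)) :
    ∫⁻ z, ‖fderiv ℝ (anisoGaussDensity d σ) z h‖ₑ =
      ENNReal.ofReal √(2 * (∑ i, h i ^ 2 / σ i ^ 2) / π) := by
  have hvar : ∑ i, (h i / σ i ^ 2) ^ 2 * σ i ^ 2 = ∑ i, h i ^ 2 / σ i ^ 2 :=
    Finset.sum_congr rfl fun i _ ↦ by
      have := (hσ i).ne'
      field_simp
  have hmeas := (contDiff_anisoGaussDensity σ).continuous.measurable.ennreal_ofReal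
  have hlaw := map_withDensity_anisoGaussDensity hσ fun i ↦ h i / σ i ^ 2
  have hmoment := lintegral_enorm_gaussianReal (Real.toNNReal (∑ i, h i ^ 2 / σ i ^ 2))
  rw [← hvar, ← hlaw, lintegral_map (by fun_prop) (by fun_prop),
    lintegral_withDensity_eq_lintegral_mul _ hmeas (by fun_prop), hvar,
    Real.coe_toNNReal _ (Finset.sum_nonneg fun i _ ↦ by positivity)] at hmoment
  rw [← hmoment]
  refine lintegral_congr fun z ↦ ?_
  rw [fderiv_anisoGaussDensity_apply, enorm_neg, enorm_mul,
    Real.enorm_of_nonneg (anisoGaussDensity_nonneg σ z), Pi.mul_apply]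

/-- The `L¹` distance between two translates of the density, bounded through any lower bound on the
standard deviations. -/
lemma integral_abs_anisoGaussDensity_sub_le {d : ℕ} {σ : Fin d → ℝ} {s : ℝ} (hs : 0 < s)
    (hσ : ∀ i, s ≤ σ i) (x y : EuclideanSpace ℝ (Fin d)) :
    ∫ z, |anisoGaussDensity d σ (z - x) - anisoGaussDensity d σ (z - y)| ≤
      √2 / (s * √π) * ‖x - y‖ := by
  have hcont := (contDiff_anisoGaussDensity σ).continuous
  rw [integral_eq_lintegral_of_nonneg_ae (ae_of_all _ fun z ↦ abs_nonneg _)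
    (by fun_prop : Continuous _).aestronglyMeasurable]
  refine ENNReal.toReal_le_of_le_ofReal (by positivity) ?_
  simp_rw [← Real.enorm_eq_ofReal_abs]
  refine (lintegral_enorm_sub_translate_le volume (contDiff_anisoGaussDensity σ) x y).trans ?_
  rw [lintegral_enorm_fderiv_anisoGaussDensity fun i ↦ hs.trans_le (hσ i)]
  refine ENNReal.ofReal_le_ofReal (Real.sqrt_le_iff.2 ⟨by positivity, ?_⟩)
  rw [mul_pow, div_pow, mul_pow, Real.sq_sqrt zero_le_two, Real.sq_sqrt pi_pos.le,
    EuclideanSpace.real_norm_sq_eq]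
  have hsum : ∑ i, (x - y) i ^ 2 / σ i ^ 2 ≤ (∑ i, (x - y) i ^ 2) / s ^ 2 := by
    rw [Finset.sum_div]
    gcongr with i _
    exact hσ i
  calc 2 * (∑ i, (x - y) i ^ 2 / σ i ^ 2) / π
      ≤ 2 * ((∑ i, (x - y) i ^ 2) / s ^ 2) / π := by gcongr
    _ = 2 / (s ^ 2 * π) * ∑ i, (x - y) i ^ 2 := by field_simp

/-- The L¹ distance between the densities of `N(x, Σ)` and `N(y, Σ)` with
`Σ = diag(σ_1², …, σ_d²)` is at most `(√2/(σ₋√π))‖x − y‖ ≤ ‖x − y‖/σ₋` where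
`σ₋ = min_i σ_i`. -/
theorem stmt_12 {d : ℕ} (hd : 0 < d) (σ : Fin d → ℝ) (hσ : ∀ i, 0 < σ i)
    (x y : EuclideanSpace ℝ (Fin d)) :
    (∫ z, |anisoGaussDensity d σ (z - x) - anisoGaussDensity d σ (z - y)|) ≤
        Real.sqrt 2 /
          (Finset.univ.inf' (Finset.univ_nonempty_iff.mpr (Fin.pos_iff_nonempty.mp hd)) σ *
            Real.sqrt π) * ‖x - y‖ ∧
      Real.sqrt 2 /
          (Finset.univ.inf' (Finset.univ_nonempty_iff.mpr (Fin.pos_iff_nonempty.mp hd)) σ *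
            Real.sqrt π) * ‖x - y‖ ≤
        ‖x - y‖ /
          Finset.univ.inf' (Finset.univ_nonempty_iff.mpr (Fin.pos_iff_nonempty.mp hd)) σ := by
  have hs : 0 < Finset.univ.inf'
      (Finset.univ_nonempty_iff.mpr (Fin.pos_iff_nonempty.mp hd)) σ := by
    simpa [Finset.lt_inf'_iff] using hσ
  refine ⟨integral_abs_anisoGaussDensity_sub_le hs
    (fun i ↦ Finset.inf'_le σ (Finset.mem_univ i)) x y, ?_⟩
  rw [div_eq_inv_mul ‖x - y‖]
  refine mul_le_mul_of_nonneg_right ?_ (norm_nonneg _)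
  rw [mul_comm, ← div_div, ← one_div]
  gcongr
  exact div_le_one_of_le₀ (Real.sqrt_le_sqrt two_le_pi) (Real.sqrt_nonneg _)
end

section
/- (Uniform stability bounds generalization error.) Let Ξ be a measurable space of examples equipped with a probability measure D, let Θ be a measurable space of parameters, and let l : Θ × Ξ → ℝ be a bounded measurable loss. Let A be a (possibly randomized) learning algorithm, modeled as a measurable map from datasets S ∈ Ξ^m (together with an independent source of randomness) to parameters in Θ. Suppose A is ε_s-uniformly stable: for every pair of datasets S, S' ∈ Ξ^m that differ in at most one coordinate, sup_{ξ∈Ξ} E_A[l(A(S); ξ) − l(A(S'); ξ)] ≤ ε_s. Then the expected generalization error satisfies E_{S∼D^m, A}[ L^{true}(A(S)) − L^S(A(S)) ] ≤ ε_s, where L^{true}(θ) = E_{ξ∼D}[l(θ; ξ)] and L^S(θ) = (1/m) Σ_{i=1}^m l(θ; S_i). -/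
open MeasureTheory Real

/-- Resampling one coordinate of an i.i.d. sample by an independent draw preserves its law. -/
lemma measurePreserving_update_pi {ι Ξ : Type*} [Fintype ι] [DecidableEq ι] [MeasurableSpace Ξ]
    (D : Measure Ξ) [IsProbabilityMeasure D] (i : ι) :
    MeasurePreserving (fun p : (ι → Ξ) × Ξ => Function.update p.1 i p.2)
      ((Measure.pi fun _ : ι => D).prod D) (Measure.pi fun _ : ι => D) := by
  have hmeas : Measurable (fun p : (ι → Ξ) × Ξ => Function.update p.1 i p.2) :=
    measurable_update'
  refine ⟨hmeas, (Measure.pi_eq fun s hs => ?_).symm⟩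
  have hpre : (fun p : (ι → Ξ) × Ξ => Function.update p.1 i p.2) ⁻¹' Set.univ.pi s
      = (Set.univ.pi (Function.update s i Set.univ)) ×ˢ s i := by
    ext ⟨S, ξ⟩
    simp only [Set.mem_preimage, Set.mem_pi, Set.mem_univ, true_implies, Set.mem_prod]
    constructor
    · refine fun h => ⟨fun j => ?_, by simpa using h i⟩
      by_cases hj : j = i
      · subst hj; simp
      · simpa [hj] using h j
    · rintro ⟨h, hξ⟩ j
      by_cases hj : j = i
      · subst hj; simpa using hξ
      · simpa [hj] using h j
  rw [Measure.map_apply hmeas (MeasurableSet.univ_pi hs), hpre, Measure.prod_prod, Measure.pi_pi,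
    ← Finset.mul_prod_erase _ _ (Finset.mem_univ i),
    ← Finset.mul_prod_erase _ (fun j => D (s j)) (Finset.mem_univ i)]
  simp only [Function.update_self, measure_univ, one_mul]
  rw [mul_comm]
  congr 1
  refine Finset.prod_congr rfl fun j hj => ?_
  rw [Function.update_of_ne (Finset.ne_of_mem_erase hj)]

/-- If replacing coordinate `i` of the sample by the test point changes the score at that point by
at most `ε`, the expected score at a fresh point exceeds the one at the `i`-th sample point by at
most `ε`. -/
lemma integral_sub_integral_eval_le {ι Ξ : Type*} [Fintype ι] [DecidableEq ι] [MeasurableSpace Ξ]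
    (D : Measure Ξ) [IsProbabilityMeasure D] (i : ι) {f : (ι → Ξ) → Ξ → ℝ}
    (hf : Measurable (Function.uncurry f)) {C : ℝ} (hC : ∀ S ξ, |f S ξ| ≤ C) {ε : ℝ}
    (hε : ∀ S ξ, f S ξ - f (Function.update S i ξ) ξ ≤ ε) :
    (∫ S, ∫ ξ, f S ξ ∂D ∂(Measure.pi fun _ : ι => D))
      - ∫ S, f S (S i) ∂(Measure.pi fun _ : ι => D) ≤ ε := by
  have hT := measurePreserving_update_pi D i
  have hfi : Measurable fun S : ι → Ξ => f S (S i) :=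
    hf.comp (measurable_id.prodMk (measurable_pi_apply i))
  have hint : Integrable (fun p : (ι → Ξ) × Ξ => f p.1 p.2) ((Measure.pi fun _ : ι => D).prod D) :=
    .of_bound hf.aestronglyMeasurable C (.of_forall fun p => hC p.1 p.2)
  have hupd : ∫ S, f S (S i) ∂(Measure.pi fun _ : ι => D)
      = ∫ p, f (Function.update p.1 i p.2) p.2 ∂((Measure.pi fun _ : ι => D).prod D) := by
    conv_lhs => rw [← hT.map_eq]
    rw [integral_map hT.measurable.aemeasurable hfi.aestronglyMeasurable]
    simp
  have hint' : Integrable (fun p : (ι → Ξ) × Ξ => f (Function.update p.1 i p.2) p.2)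
      ((Measure.pi fun _ : ι => D).prod D) :=
    .of_bound (hf.comp (hT.measurable.prodMk measurable_snd)).aestronglyMeasurable C
      (.of_forall fun p => hC _ _)
  rw [hupd, integral_integral hint, ← integral_sub hint hint']
  calc _ ≤ ∫ _, ε ∂((Measure.pi fun _ : ι => D).prod D) :=
        integral_mono (hint.sub hint') (integrable_const _) fun p => hε p.1 p.2
    _ = ε := by simp

/-- Uniform stability bounds generalization error: if a (possibly randomized) algorithm `A`
is `ε_s`-uniformly stable, then its expected generalization gap
`E_{S∼D^m, A}[L^{true}(A(S)) − L^S(A(S))]` is at most `ε_s`. -/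
theorem stmt_15 {Ξ Θ Ω : Type*} [MeasurableSpace Ξ] [MeasurableSpace Θ] [MeasurableSpace Ω]
    (D : Measure Ξ) [IsProbabilityMeasure D]
    (P : Measure Ω) [IsProbabilityMeasure P]
    (m : ℕ) (hm : 0 < m)
    (l : Θ → Ξ → ℝ) (hlmeas : Measurable (Function.uncurry l))
    (C : ℝ) (hbound : ∀ θ ξ, |l θ ξ| ≤ C)
    (A : (Fin m → Ξ) → Ω → Θ) (hAmeas : Measurable (Function.uncurry A))
    (εs : ℝ)
    (hstable : ∀ S S' : Fin m → Ξ, (∃ j, ∀ i, i ≠ j → S i = S' i) →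
      ∀ ξ : Ξ, (∫ ω, (l (A S ω) ξ - l (A S' ω) ξ) ∂P) ≤ εs) :
    (∫ S, ∫ ω,
        ((∫ ξ, l (A S ω) ξ ∂D) - (1 / (m : ℝ)) * ∑ i, l (A S ω) (S i)) ∂P
      ∂(Measure.pi fun _ : Fin m => D)) ≤ εs := by
  have hloss : Measurable fun q : ((Fin m → Ξ) × Ξ) × Ω => l (A q.1.1 q.2) q.1.2 :=
    hlmeas.comp ((hAmeas.comp (measurable_fst.fst.prodMk measurable_snd)).prodMk measurable_fst.snd)
  let f : (Fin m → Ξ) → Ξ → ℝ := fun S ξ => ∫ ω, l (A S ω) ξ ∂P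
  have hf : Measurable (Function.uncurry f) :=
    (hloss.stronglyMeasurable.integral_prod_right' (ν := P)).measurable
  have hlω : ∀ S ξ, Integrable (fun ω => l (A S ω) ξ) P := fun S ξ =>
    .of_bound (hloss.comp (measurable_const.prodMk measurable_id :
      Measurable fun ω : Ω => ((S, ξ), ω))).aestronglyMeasurable C (.of_forall fun _ => hbound _ _)
  have hfC : ∀ S ξ, |f S ξ| ≤ C := fun S ξ => by
    simpa using norm_integral_le_of_norm_le_const (μ := P)
      (f := fun ω => l (A S ω) ξ) (.of_forall fun ω => hbound (A S ω) ξ)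
  have hlωξ : ∀ S, Integrable (Function.uncurry fun ω ξ => l (A S ω) ξ) (P.prod D) := fun S =>
    .of_bound (hloss.comp ((measurable_const.prodMk measurable_snd).prodMk measurable_fst :
      Measurable fun p : Ω × Ξ => ((S, p.2), p.1))).aestronglyMeasurable C
      (.of_forall fun _ => hbound _ _)
  have hinner : ∀ S, (∫ ω, ((∫ ξ, l (A S ω) ξ ∂D) - (1 / (m : ℝ)) * ∑ i, l (A S ω) (S i)) ∂P)
      = (∫ ξ, f S ξ ∂D) - (1 / (m : ℝ)) * ∑ i, f S (S i) := fun S => by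
    have hpop : Integrable (fun ω => ∫ ξ, l (A S ω) ξ ∂D) P := (hlωξ S).integral_prod_left
    rw [integral_sub hpop
      ((integrable_finsetSum _ fun i _ => hlω S (S i)).const_mul _), integral_const_mul,
      integral_finsetSum _ fun i _ => hlω S (S i), integral_integral_swap (hlωξ S)]
  have hrisk : Integrable (fun S => ∫ ξ, f S ξ ∂D) (Measure.pi fun _ : Fin m => D) :=
    (Integrable.of_bound hf.aestronglyMeasurable C
      (.of_forall fun p => hfC p.1 p.2)).integral_prod_left
  have heval : ∀ i, Integrable (fun S => f S (S i)) (Measure.pi fun _ : Fin m => D) := fun i =>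
    .of_bound (hf.comp (measurable_id.prodMk (measurable_pi_apply i))).aestronglyMeasurable C
      (.of_forall fun _ => hfC _ _)
  have hcoord : ∀ i, (∫ S, ∫ ξ, f S ξ ∂D ∂(Measure.pi fun _ : Fin m => D))
      - ∫ S, f S (S i) ∂(Measure.pi fun _ : Fin m => D) ≤ εs := fun i =>
    integral_sub_integral_eval_le D i hf hfC fun S ξ => by
      rw [← integral_sub (hlω _ _) (hlω _ _)]
      exact hstable _ _ ⟨i, fun j hj => (Function.update_of_ne hj _ _).symm⟩ ξ
  have hm' : (0 : ℝ) < m := by exact_mod_cast hm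
  simp_rw [hinner]
  rw [integral_sub hrisk ((integrable_finsetSum _ fun i _ => heval i).const_mul _),
    integral_const_mul, integral_finsetSum _ fun i _ => heval i]
  have hsum := Finset.sum_le_sum fun i (_ : i ∈ Finset.univ) => hcoord i
  simp only [Finset.sum_sub_distrib, Finset.sum_const, Finset.card_univ, Fintype.card_fin,
    nsmul_eq_mul] at hsum
  refine le_of_mul_le_mul_left ?_ hm'
  rwa [mul_sub, ← mul_assoc, mul_one_div_cancel hm'.ne', one_mul]
end
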